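/- Let χ̃ be a Hecke character of weight one of ℚ(ρ) with conductor (β). Then ϖ₁^{−1}·L(1, χ̃) = (1/(6β))·Σ_{λ mod β} χ₁(λ)·Z(λ/β). -/

import Mathlib

open Complex BigOperators

noncomputable section

/-- `ρ = e^{2πi/3}`, a primitive cube root of unity. -/
def ρ3 : ℂ := Complex.exp (2 * Real.pi * Complex.I / 3)

/-- The ring of Eisenstein integers `ℤ[ρ]`, realized as a subring of `ℂ`. -/
def O3 : Subring ℂ := Subring.closure {ρ3}

/-- `√−3 = i·√3`. -/
def sqrtm3 : ℂ := Complex.I * (Real.sqrt 3 : ℝ)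

/-- The congruence `a ≡ b (mod c)` in `ℤ[ρ]`. -/
def ECong (a b c : ℂ) : Prop := ∃ d ∈ O3, a - b = c * d

/-- `a` and `b` are coprime in `ℤ[ρ]`. -/
def ECoprime (a b : ℂ) : Prop := ∃ u ∈ O3, ∃ v ∈ O3, u * a + v * b = 1

/-- The real period `ϖ₁ = ∫₀¹ (1−x³)^{−2/3} dx`. -/
def varpi1 : ℝ := ∫ x in (0:ℝ)..(1:ℝ), (1 - x ^ 3) ^ (-(2:ℝ)/3)

/-- The points of the period lattice `ϖ₁·ℤ[ρ]`. -/
def ω3 (m : ℤ × ℤ) : ℂ := (varpi1 : ℂ) * ((m.1 : ℂ) + (m.2 : ℂ) * ρ3)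

/-- The Weierstrass `℘`-function of the period lattice `ϖ₁·ℤ[ρ]`
(so that `℘′² = 4℘³ − 27`). -/
def wp3 (u : ℂ) : ℂ :=
  (u ^ 2)⁻¹ + ∑' m : ℤ × ℤ, if m = 0 then 0 else (((u - ω3 m) ^ 2)⁻¹ - ((ω3 m) ^ 2)⁻¹)

/-- The derivative `℘′` of the Weierstrass `℘`-function of `ϖ₁·ℤ[ρ]`. -/
def wp3' (u : ℂ) : ℂ := ∑' m : ℤ × ℤ, (-2) * ((u - ω3 m) ^ 3)⁻¹

/-- The Weierstrass `ζ`-function of the period lattice `ϖ₁·ℤ[ρ]`. -/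
def wzeta3 (u : ℂ) : ℂ :=
  u⁻¹ + ∑' m : ℤ × ℤ, if m = 0 then 0 else ((u - ω3 m)⁻¹ + (ω3 m)⁻¹ + u * ((ω3 m) ^ 2)⁻¹)

/-- The non-analytic doubly periodic function `Z(u) = ζ(ϖ₁u) − (2π/(√3·ϖ₁))·ū`. -/
def Z3 (u : ℂ) : ℂ :=
  wzeta3 ((varpi1 : ℂ) * u) -
    ((2 * Real.pi / (Real.sqrt 3 * varpi1) : ℝ) : ℂ) * (starRingEnd ℂ) u

/-- The elliptic function `φ(u) = 6℘(ϖ₁u)/(9+℘′(ϖ₁u))` of period lattice `ℤ[ρ]`. -/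
def phi3 (u : ℂ) : ℂ := 6 * wp3 ((varpi1 : ℂ) * u) / (9 + wp3' ((varpi1 : ℂ) * u))

/-- The elliptic function `ψ(u) = (9−℘′(ϖ₁u))/(9+℘′(ϖ₁u))` of period lattice `ℤ[ρ]`. -/
def psi3 (u : ℂ) : ℂ := (9 - wp3' ((varpi1 : ℂ) * u)) / (9 + wp3' ((varpi1 : ℂ) * u))

/-- A residue class character modulo `β` on `ℤ[ρ]`. -/
structure IsResChar3 (β : ℂ) (χ : ℂ → ℂ) : Prop where
  periodic : ∀ a ∈ O3, ∀ b ∈ O3, ECong a b β → χ a = χ b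
  map_mul : ∀ a ∈ O3, ∀ b ∈ O3, χ (a * b) = χ a * χ b
  map_one : χ 1 = 1
  vanish : ∀ a ∈ O3, ¬ ECoprime a β → χ a = 0

/-- The cubic residue character `χ_π = (·/π)₃` modulo a prime `π` with `p = π·π̄`:
`χ_π(ν)³ = 1` and `χ_π(ν) ≡ ν^{(p−1)/3} (mod π)`. -/
structure IsCubicChar (π : ℂ) (p : ℕ) (χ : ℂ → ℂ) : Prop where
  resChar : IsResChar3 π χ
  cube : ∀ ν ∈ O3, ECoprime ν π → χ ν ^ 3 = 1
  euler : ∀ ν ∈ O3, ECoprime ν π → ECong (χ ν) (ν ^ ((p - 1) / 3)) π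

/-- The elliptic Gauss sum `G_π(χ, f) = (1/3)·Σ_{ν ∈ (ℤ[ρ]/(π))^×} χ(ν)·f(ν/π)`,
computed via the integer representatives `1, …, p−1` of `(ℤ[ρ]/(π))^× ≅ (ℤ/p)^×`. -/
def EGS3 (p : ℕ) (χ f : ℂ → ℂ) (π : ℂ) : ℂ :=
  (1/3 : ℂ) * ∑ r ∈ Finset.Icc 1 (p - 1), χ (r : ℂ) * f ((r : ℂ) / π)

/-- `S` is a third set of `(ℤ[ρ]/(π))^×`, i.e. `(ℤ[ρ]/(π))^× = S ∪ ρS ∪ ρ̄S`. -/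
def IsThirdSet (π : ℂ) (S : Finset ℂ) : Prop :=
  (∀ ν ∈ S, ν ∈ O3 ∧ ECoprime ν π) ∧
  (∀ a ∈ O3, ECoprime a π →
    ∃ ν ∈ S, ∃ ε ∈ ({1, ρ3, ρ3 ^ 2} : Set ℂ), ECong a (ε * ν) π) ∧
  (∀ ν ∈ S, ∀ μ ∈ S, ∀ ε ∈ ({1, ρ3, ρ3 ^ 2} : Set ℂ), ∀ ε' ∈ ({1, ρ3, ρ3 ^ 2} : Set ℂ),
    ECong (ε * ν) (ε' * μ) π → ν = μ ∧ ε = ε')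

/-- `γ(S)` is the cube root of unity with `γ(S) ≡ −∏_{ν∈S} ν (mod π)`. -/
def IsGamma3 (π : ℂ) (S : Finset ℂ) (γ : ℂ) : Prop :=
  γ ^ 3 = 1 ∧ ECong γ (-(∏ ν ∈ S, ν)) π

/-- `L` is the value at `s = 1` of the analytic continuation of the Hecke `L`-series
`L(s, χ̃) = Σ_𝔞 χ̃(𝔞)·N𝔞^{−s} = (1/6)·Σ_{ν ∈ ℤ[ρ]} χ₁(ν)·ν̄·|ν|^{−2s}` attached to the
weight-one Hecke character `χ̃((ν)) = χ₁(ν)·ν̄` of `ℚ(ρ)`. -/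
def IsLValue3 (χ₁ : ℂ → ℂ) (L : ℂ) : Prop :=
  ∃ F : ℂ → ℂ, DifferentiableOn ℂ F {s : ℂ | 0 < s.re} ∧
    (∀ s : ℂ, 3/2 < s.re →
      F s = (1/6 : ℂ) *
        ∑' ν : O3, χ₁ (ν : ℂ) * (starRingEnd ℂ) (ν : ℂ) *
          ((Complex.normSq (ν : ℂ) : ℂ) ^ (-s))) ∧
    F 1 = L

/-- `T` is a complete residue system modulo `β` in `ℤ[ρ]`. -/
def IsCRS3 (β : ℂ) (T : Finset ℂ) : Prop :=
  (∀ a ∈ T, a ∈ O3) ∧ (∀ a ∈ T, ∀ b ∈ T, ECong a b β → a = b) ∧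
  (∀ z ∈ O3, ∃ a ∈ T, ECong z a β)

/-- `e^{2πi·S(z)}` where `S(a + b·ρ̄) = a`, i.e. `2πi·S(z) = (2π/√3)·(zρ − z̄ρ̄)`. -/
def eS3 (z : ℂ) : ℂ :=
  Complex.exp (((2 * Real.pi / Real.sqrt 3 : ℝ) : ℂ) *
    (z * ρ3 - (starRingEnd ℂ) z * (starRingEnd ℂ) ρ3))

/-- `χ₀`: the character mod `3` giving the natural isomorphism `(ℤ[ρ]/(3))^× ≅ W`,
i.e. `χ₀(ν) = ε` for `ν ≡ ε (mod 3)`, `ε ∈ W = {±1, ±ρ, ±ρ̄}`. -/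
def IsChi0₃ (χ₀ : ℂ → ℂ) : Prop :=
  IsResChar3 3 χ₀ ∧ ∀ ε ∈ ({1, -1, ρ3, -ρ3, ρ3 ^ 2, -ρ3 ^ 2} : Set ℂ), χ₀ ε = ε

/-- `χ₀′`: the character mod `√−3` giving `(ℤ[ρ]/(√−3))^× ≅ {±1}`,
i.e. `χ₀′(ν) = δ` for `ν ≡ δ (mod √−3)`, `δ ∈ {±1}`. -/
def IsChi0'₃ (χ₀' : ℂ → ℂ) : Prop :=
  IsResChar3 sqrtm3 χ₀' ∧ χ₀' (-1) = -1

/-- The classical cubic (Kummer) Gauss sum `G₃(π) = Σ_{r=1}^{p−1} (r/π)₃·e^{2πir/p}`. -/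
def G3sum (p : ℕ) (χ : ℂ → ℂ) : ℂ :=
  ∑ r ∈ Finset.Icc 1 (p - 1), χ (r : ℂ) * Complex.exp (2 * Real.pi * Complex.I * (r : ℂ) / (p : ℂ))

/-- `χ` is a primitive residue class character modulo `β` on `ℤ[ρ]`. -/
def IsPrimitive3 (β : ℂ) (χ : ℂ → ℂ) : Prop :=
  ∀ β' ∈ O3, (∃ c ∈ O3, β = β' * c) → ¬ (∃ c ∈ O3, β' = β * c) →
    ∃ a ∈ O3, ECoprime a β ∧ ECong a 1 β' ∧ χ a ≠ 1

/-- `χ̃((ν)) = χ₁(ν)·ν̄` is a Hecke character of weight one of `ℚ(ρ)` with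
conductor `(β)`: `χ₁` is a primitive residue class character mod `(β)` with
`χ₁(ε) = ε` for every unit `ε ∈ W = {±1, ±ρ, ±ρ̄}`. -/
def IsHeckeCond3 (β : ℂ) (χ₁ : ℂ → ℂ) : Prop :=
  β ∈ O3 ∧ β ≠ 0 ∧ IsResChar3 β χ₁ ∧
    (∀ ε ∈ ({1, -1, ρ3, -ρ3, ρ3 ^ 2, -ρ3 ^ 2} : Set ℂ), χ₁ ε = ε) ∧
    IsPrimitive3 β χ₁

open Filter Topology

section Estimate

lemma norm_one_add_conj_mul_exp_sub_le {M : ℝ} (hM : 1 ≤ M) {s w : ℂ} (hs : ‖s‖ ≤ M)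
    (hw : ‖w‖ ≤ 1 / (8 * M)) (hw1 : 1 + w ≠ 0) :
    ‖(1 + (starRingEnd ℂ) w) * ((normSq (1 + w) : ℝ) : ℂ) ^ (-s) - 1 + s * w
      - (1 - s) * (starRingEnd ℂ) w‖ ≤ 46 * M ^ 2 * ‖w‖ ^ 2 := by
  set v := (starRingEnd ℂ) w with hv
  have hvn : ‖v‖ = ‖w‖ := by simp [hv]
  set x : ℂ := w + v + w * v with hx
  have hN : ((normSq (1 + w) : ℝ) : ℂ) = 1 + x := by
    rw [← mul_conj, map_add, map_one, hx]; ring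
  have hw0 := norm_nonneg w
  have hMw : M * ‖w‖ ≤ 1 / 8 := by
    rw [le_div_iff₀ (by positivity)] at hw; linarith
  have hw8 : ‖w‖ ≤ 1 / 8 := by nlinarith
  have hxn : ‖x‖ ≤ 3 * ‖w‖ := by
    have h1 : ‖x‖ ≤ ‖w‖ + ‖v‖ + ‖w‖ * ‖v‖ := by
      rw [hx, ← norm_mul]; exact norm_add₃_le
    rw [hvn] at h1; nlinarith
  have hN0 : ((normSq (1 + w) : ℝ) : ℂ) ≠ 0 := by
    simpa using hw1
  set l := log (1 + x) with hl
  have hl1 : ‖l - x‖ ≤ 9 * ‖w‖ ^ 2 := by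
    have h1 : ‖x‖ < 1 := by linarith
    refine (norm_log_one_add_sub_self_le h1).trans ?_
    have h2 : (1 - ‖x‖)⁻¹ ≤ 2 := by
      rw [inv_le_comm₀ (by linarith) (by norm_num)]; linarith
    calc ‖x‖ ^ 2 * (1 - ‖x‖)⁻¹ / 2 ≤ ‖x‖ ^ 2 * 2 / 2 := by gcongr
      _ = ‖x‖ ^ 2 := by ring
      _ ≤ (3 * ‖w‖) ^ 2 := by gcongr
      _ = _ := by ring
  have hl2 : ‖l - w - v‖ ≤ 10 * ‖w‖ ^ 2 := by
    have : l - w - v = (l - x) + w * v := by rw [hx]; ring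
    rw [this]
    refine (norm_add_le _ _).trans ?_
    rw [norm_mul, hvn]; linarith
  have hl3 : ‖l‖ ≤ 4 * ‖w‖ := by
    have : l = (l - w - v) + w + v := by ring
    rw [this]
    refine norm_add₃_le.trans ?_
    rw [hvn]; nlinarith
  set y := -s * l with hy
  have hyn : ‖y‖ ≤ 4 * (M * ‖w‖) := by
    rw [hy, norm_mul, norm_neg]
    calc ‖s‖ * ‖l‖ ≤ M * (4 * ‖w‖) := by gcongr
      _ = _ := by ring
  set e := exp y - 1 - y with he
  have hen : ‖e‖ ≤ 16 * (M * ‖w‖) ^ 2 := by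
    refine (norm_exp_sub_one_sub_id_le (by linarith)).trans ?_
    calc ‖y‖ ^ 2 ≤ (4 * (M * ‖w‖)) ^ 2 := by gcongr
      _ = _ := by ring
  have hc : ((normSq (1 + w) : ℝ) : ℂ) ^ (-s) = 1 + y + e := by
    rw [cpow_def_of_ne_zero hN0, hN, ← hl, mul_comm, ← hy, he]; ring
  have key : (1 + v) * ((normSq (1 + w) : ℝ) : ℂ) ^ (-s) - 1 + s * w - (1 - s) * v
      = -s * (l - w - v) + e + (v * y + v * e) := by
    rw [hc, hy]; ring
  rw [key]
  have h1 : ‖-s * (l - w - v)‖ ≤ M * (10 * ‖w‖ ^ 2) := by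
    rw [norm_mul, norm_neg]; gcongr
  have h2 : ‖v * y‖ ≤ ‖w‖ * (4 * (M * ‖w‖)) := by
    rw [norm_mul, hvn]; gcongr
  have h3 : ‖v * e‖ ≤ ‖w‖ * (16 * (M * ‖w‖) ^ 2) := by
    rw [norm_mul, hvn]; gcongr
  have h4 := norm_add₃_le (a := -s * (l - w - v)) (b := e) (c := v * y + v * e)
  have h5 := norm_add_le (v * y) (v * e)
  have h6 : M * ‖w‖ ^ 2 ≤ M ^ 2 * ‖w‖ ^ 2 := by
    gcongr; nlinarith
  have h7 : ‖w‖ * (16 * (M * ‖w‖) ^ 2) ≤ 1 * (16 * (M * ‖w‖) ^ 2) := by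
    gcongr; linarith
  nlinarith

end Estimate

section Series

variable {ι : Type*}

lemma differentiableOn_tsum_of_eventually_bound {F : ι → ℂ → ℂ} {U : Set ℂ} (hU : IsOpen U)
    (hF : ∀ i, DifferentiableOn ℂ (F i) U)
    (hb : ∀ K ⊆ U, IsCompact K → ∃ b : ι → ℝ, Summable b ∧
      ∀ᶠ i in cofinite, ∀ s ∈ K, ‖F i s‖ ≤ b i) :
    DifferentiableOn ℂ (fun s ↦ ∑' i, F i s) U := by
  intro s₀ hs₀
  obtain ⟨K, hK, hsK, hKU⟩ := exists_compact_subset hU hs₀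
  obtain ⟨b, hbs, hbe⟩ := hb K hKU hK
  choose C hC using fun i ↦ hK.exists_bound_of_continuousOn ((hF i).continuousOn.mono hKU)
  classical
  let P : ι → Prop := fun i ↦ ∀ s ∈ K, ‖F i s‖ ≤ b i
  have hsum : Summable fun i ↦ if P i then b i else C i := by
    refine (summable_congr_cofinite ?_).2 hbs
    filter_upwards [hbe] with i hi
    exact if_pos hi
  have := differentiableOn_tsum_of_summable_norm (F := F) (U := interior K) hsum
    (fun i ↦ (hF i).mono (interior_subset.trans hKU)) isOpen_interior fun i s hs ↦ by
      by_cases h : P i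
      · simpa [h] using h s (interior_subset hs)
      · simpa [h] using hC i s (interior_subset hs)
  exact ((this s₀ hsK).differentiableAt (isOpen_interior.mem_nhds hsK)).differentiableWithinAt

end Series

section Terms

/-- The function `z ↦ z̄·|z|^{-2 s}`. -/
def conjTerm (s z : ℂ) : ℂ := (starRingEnd ℂ) z * (normSq z : ℂ) ^ (-s)

/-- The function `z ↦ z̄²·|z|^{-2 s - 2}`. -/
def conjSqTerm (s z : ℂ) : ℂ := (starRingEnd ℂ) z ^ 2 * (normSq z : ℂ) ^ (-(s + 1))

/-- The remainder in the first-order expansion of `conjTerm s` at `z`, evaluated at `u + z`. -/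
def conjRemainder (u s z : ℂ) : ℂ :=
  conjTerm s (u + z) - conjTerm s z + s * u * conjSqTerm s z
    - (1 - s) * (starRingEnd ℂ) u * (normSq z : ℂ) ^ (-s)

lemma norm_normSq_cpow {s : ℂ} (hs : s.re ≠ 0) (z : ℂ) :
    ‖(normSq z : ℂ) ^ (-s)‖ = ‖z‖ ^ (-2 * s.re) := by
  rcases eq_or_ne z 0 with rfl | hz
  · have hs' : s ≠ 0 := fun h ↦ hs (by simp [h])
    rw [map_zero, ofReal_zero, zero_cpow (neg_ne_zero.2 hs'), norm_zero,
      Real.zero_rpow (by simpa using hs)]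
  · rw [norm_cpow_eq_rpow_re_of_pos (normSq_pos.2 hz), normSq_eq_norm_sq, ← Real.rpow_natCast,
      ← Real.rpow_mul (norm_nonneg z)]
    congr 1
    simp

lemma norm_conjTerm {s : ℂ} (hs : 1 / 2 < s.re) (z : ℂ) :
    ‖conjTerm s z‖ = ‖z‖ ^ (1 - 2 * s.re) := by
  rw [conjTerm, norm_mul, norm_normSq_cpow (by linarith), RCLike.norm_conj]
  rcases eq_or_ne z 0 with rfl | hz
  · rw [norm_zero, zero_mul, Real.zero_rpow (by linarith)]
  · rw [sub_eq_add_neg, Real.rpow_add (norm_pos_iff.2 hz), Real.rpow_one, neg_mul]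

lemma norm_conjSqTerm {s : ℂ} (hs : 1 / 2 < s.re) (z : ℂ) :
    ‖conjSqTerm s z‖ = ‖z‖ ^ (-2 * s.re) := by
  rw [conjSqTerm, norm_mul, norm_pow, norm_normSq_cpow (by rw [add_re, one_re]; linarith), RCLike.norm_conj]
  rcases eq_or_ne z 0 with rfl | hz
  · rw [norm_zero, Real.zero_rpow (by linarith : -2 * s.re ≠ 0)]; simp
  · rw [← Real.rpow_natCast, ← Real.rpow_add (norm_pos_iff.2 hz)]
    congr 1
    simp; ring

lemma differentiableAt_normSq_cpow {s : ℂ} (hs : s ≠ 0) (z : ℂ) :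
    DifferentiableAt ℂ (fun s ↦ (normSq z : ℂ) ^ (-s)) s :=
  differentiableAt_id.neg.const_cpow (.inr (neg_ne_zero.2 hs))

lemma differentiableAt_conjRemainder {s : ℂ} (hs : 0 < s.re) (u z : ℂ) :
    DifferentiableAt ℂ (fun s ↦ conjRemainder u s z) s := by
  have h0 : s ≠ 0 := fun h ↦ by simp [h] at hs
  have h1 : s + 1 ≠ 0 := fun h ↦ by
    have := congrArg re h
    simp at this; linarith
  have h2 : DifferentiableAt ℂ (fun s ↦ (normSq z : ℂ) ^ (-(s + 1))) s :=
    (differentiableAt_id.add_const 1).neg.const_cpow (.inr (neg_ne_zero.2 h1))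
  have h3 := differentiableAt_normSq_cpow h0 z
  have h4 := differentiableAt_normSq_cpow h0 (u + z)
  unfold conjRemainder conjTerm conjSqTerm
  fun_prop

lemma normSq_mul_cpow (a b s : ℂ) :
    (normSq (a * b) : ℂ) ^ s = (normSq a : ℂ) ^ s * (normSq b : ℂ) ^ s := by
  rw [map_mul, ofReal_mul, mul_cpow_ofReal_nonneg (normSq_nonneg a) (normSq_nonneg b)]

lemma conjTerm_mul (s a b : ℂ) : conjTerm s (a * b) = conjTerm s a * conjTerm s b := by
  rw [conjTerm, normSq_mul_cpow, map_mul, conjTerm, conjTerm]; ring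

lemma conjSqTerm_mul (s a b : ℂ) :
    conjSqTerm s (a * b) = conjSqTerm s a * conjSqTerm s b := by
  rw [conjSqTerm, normSq_mul_cpow, map_mul, conjSqTerm, conjSqTerm]; ring

lemma conjRemainder_eq {z : ℂ} (hz : z ≠ 0) (u s : ℂ) :
    conjRemainder u s z = conjTerm s z * ((1 + (starRingEnd ℂ) (u / z)) *
      ((normSq (1 + u / z) : ℝ) : ℂ) ^ (-s) - 1 + s * (u / z)
      - (1 - s) * (starRingEnd ℂ) (u / z)) := by
  have hz' : (starRingEnd ℂ) z ≠ 0 := by simpa using hz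
  have h1 : u + z = z * (1 + u / z) := by field_simp; ring
  have h2 : (normSq z : ℂ) ≠ 0 := by simpa using hz
  have h3 : conjSqTerm s z * z = conjTerm s z := by
    rw [conjSqTerm, conjTerm, neg_add, cpow_add _ _ h2, cpow_neg_one, ← mul_conj]
    field_simp
  have h4 : (normSq z : ℂ) ^ (-s) = conjTerm s z / (starRingEnd ℂ) z := by
    rw [conjTerm]; field_simp
  rw [conjRemainder, h1, conjTerm_mul, h4, ← h3, map_div₀]
  have h5 : conjTerm s (1 + u / z) =
      (1 + (starRingEnd ℂ) u / (starRingEnd ℂ) z) * (normSq (1 + u / z) : ℂ) ^ (-s) := by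
    rw [conjTerm, map_add, map_one, map_div₀]
  rw [h5]
  field_simp

lemma norm_conjRemainder_le {M : ℝ} (hM : 1 ≤ M) {u s z : ℂ} (hs : ‖s‖ ≤ M)
    (hσ : 1 / 2 < s.re) (hz : z ≠ 0) (huz : 8 * M * ‖u‖ ≤ ‖z‖) (hu : ‖u‖ < ‖z‖) :
    ‖conjRemainder u s z‖ ≤ 46 * M ^ 2 * ‖u‖ ^ 2 * ‖z‖ ^ (-1 - 2 * s.re) := by
  have hz0 := norm_pos_iff.2 hz
  have h1 : 1 + u / z ≠ 0 := by
    intro h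
    have : u = -z := by
      field_simp at h
      linear_combination h
    simp [this] at hu
  have h2 : ‖u / z‖ ≤ 1 / (8 * M) := by
    rw [norm_div, div_le_div_iff₀ hz0 (by positivity)]; linarith
  rw [conjRemainder_eq hz, norm_mul, norm_conjTerm hσ]
  calc _ ≤ ‖z‖ ^ (1 - 2 * s.re) * (46 * M ^ 2 * ‖u / z‖ ^ 2) := by
        gcongr; exact norm_one_add_conj_mul_exp_sub_le hM hs h2 h1
    _ = _ := by
      rw [show -1 - 2 * s.re = (1 - 2 * s.re) - (2 : ℕ) by push_cast; ring,
        Real.rpow_sub_natCast hz0.ne', norm_div]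
      field_simp

end Terms

section Lattice

lemma exists_re_bound_of_isCompact {a : ℝ} {K : Set ℂ} (hK : IsCompact K)
    (hKa : K ⊆ {s | a < s.re}) :
    ∃ σ > a, ∃ M ≥ 1, ∀ s ∈ K, σ ≤ s.re ∧ ‖s‖ ≤ M := by
  rcases K.eq_empty_or_nonempty with rfl | hne
  · exact ⟨a + 1, by linarith, 1, le_rfl, by simp⟩
  obtain ⟨s₀, hs₀, hmin⟩ := hK.exists_isMinOn hne continuous_re.continuousOn
  obtain ⟨C, hC⟩ := hK.exists_bound_of_continuousOn (f := id) continuousOn_id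
  exact ⟨s₀.re, hKa hs₀, max 1 C, le_max_left _ _, fun s hs ↦
    ⟨hmin hs, (hC s hs).trans (le_max_right _ _)⟩⟩

lemma tsum_conjTerm (Λ : Submodule ℤ ℂ) (s : ℂ) : ∑' z : Λ, conjTerm s (z : ℂ) = 0 := by
  have h := (Equiv.neg Λ).tsum_eq fun z : Λ ↦ conjTerm s z
  have h1 (z : Λ) : conjTerm s ((Equiv.neg Λ z : Λ) : ℂ) = -conjTerm s z := by
    simp [conjTerm]
  simp_rw [h1, tsum_neg] at h
  exact self_eq_neg.1 h.symm

variable (Λ : Submodule ℤ ℂ) [DiscreteTopology Λ]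

lemma eventually_cofinite_lt_norm (R : ℝ) : ∀ᶠ z : Λ in cofinite, R < ‖(z : ℂ)‖ := by
  have H : IsClosed (X := ℂ) Λ := @AddSubgroup.isClosed_of_discrete _ _ _ _ _
    Λ.toAddSubgroup (inferInstanceAs (DiscreteTopology Λ))
  refine ((Metric.finite_isBounded_inter_isClosed DiscreteTopology.isDiscrete
    (Metric.isBounded_closedBall (x := (0 : ℂ)) (r := R)) H).preimage_embedding
    (.subtype _)).subset ?_
  intro t ht
  simpa using ht

variable [IsZLattice ℝ Λ]

lemma finrank_lattice_complex : Module.finrank ℤ Λ = 2 := by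
  rw [ZLattice.rank ℝ Λ, finrank_real_complex]

lemma summable_norm_add_rpow {r : ℝ} (hr : r < -2) (u : ℂ) :
    Summable fun z : Λ ↦ ‖u + z‖ ^ r := by
  have := ZLattice.summable_norm_sub_rpow Λ r
    (by rw [finrank_lattice_complex]; exact_mod_cast hr) (-u)
  simpa [add_comm] using this

lemma summable_norm_rpow_lattice {r : ℝ} (hr : r < -2) : Summable fun z : Λ ↦ ‖(z : ℂ)‖ ^ r := by
  simpa using summable_norm_add_rpow Λ hr 0

lemma conjRemainder_bound (u : ℂ) {K : Set ℂ} (hKs : K ⊆ {s | 1 / 2 < s.re}) (hK : IsCompact K) :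
    ∃ b : Λ → ℝ, Summable b ∧ ∀ᶠ z : Λ in cofinite, ∀ s ∈ K, ‖conjRemainder u s z‖ ≤ b z := by
  obtain ⟨σ, hσ, M, hM, hsK⟩ := exists_re_bound_of_isCompact hK hKs
  refine ⟨_, (summable_norm_rpow_lattice Λ (r := -1 - 2 * σ) (by linarith)).mul_left
    (46 * M ^ 2 * ‖u‖ ^ 2), ?_⟩
  filter_upwards [eventually_cofinite_lt_norm Λ (8 * M * ‖u‖), eventually_cofinite_lt_norm Λ ‖u‖,
    eventually_cofinite_lt_norm Λ 1] with z h1 h2 h3 s hs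
  refine (norm_conjRemainder_le hM (hsK s hs).2 (hKs hs)
    (norm_pos_iff.1 (by linarith)) h1.le h2).trans ?_
  gcongr
  · exact h3.le
  · exact (hsK s hs).1

lemma differentiableOn_tsum_conjRemainder (u : ℂ) :
    DifferentiableOn ℂ (fun s ↦ ∑' z : Λ, conjRemainder u s z) {s | 1 / 2 < s.re} :=
  differentiableOn_tsum_of_eventually_bound (isOpen_lt continuous_const continuous_re)
    (fun z s hs ↦ (differentiableAt_conjRemainder
      (lt_trans (by norm_num) hs) u z).differentiableWithinAt)
    fun _ hKs hK ↦ conjRemainder_bound Λ u hKs hK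

lemma summable_conjRemainder (u : ℂ) {s : ℂ} (hs : 1 / 2 < s.re) :
    Summable fun z : Λ ↦ conjRemainder u s z := by
  obtain ⟨b, hb, he⟩ := conjRemainder_bound Λ u (K := {s}) (by simpa using hs) isCompact_singleton
  exact .of_norm_bounded_eventually hb (he.mono fun z hz ↦ hz s rfl)

lemma summable_normSq_cpow {s : ℂ} (hs : 1 < s.re) :
    Summable fun z : Λ ↦ (normSq (z : ℂ) : ℂ) ^ (-s) := by
  refine .of_norm ?_
  simp_rw [norm_normSq_cpow (show s.re ≠ 0 by linarith)]
  exact summable_norm_rpow_lattice Λ (by linarith)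

lemma differentiableOn_tsum_normSq_cpow :
    DifferentiableOn ℂ (fun s : ℂ ↦ ∑' z : Λ, (normSq (z : ℂ) : ℂ) ^ (-s)) {s | 1 < s.re} := by
  refine differentiableOn_tsum_of_eventually_bound (isOpen_lt continuous_const continuous_re)
    (fun z s hs ↦ (differentiableAt_normSq_cpow ?_ _).differentiableWithinAt) fun K hKs hK ↦ ?_
  · rintro rfl
    simp only [Set.mem_ofPred_eq, zero_re] at hs
    linarith
  · obtain ⟨σ, hσ, M, hM, hsK⟩ := exists_re_bound_of_isCompact hK hKs
    refine ⟨_, summable_norm_rpow_lattice Λ (r := -2 * σ) (by linarith), ?_⟩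
    filter_upwards [eventually_cofinite_lt_norm Λ 1] with z hz s hs
    have := (hsK s hs).1
    rw [norm_normSq_cpow (by linarith)]
    exact Real.rpow_le_rpow_of_exponent_le hz.le (by linarith)

lemma summable_conjTerm_add (u : ℂ) {s : ℂ} (hs : 3 / 2 < s.re) :
    Summable fun z : Λ ↦ conjTerm s (u + z) := by
  refine .of_norm ?_
  simp_rw [norm_conjTerm (show 1 / 2 < s.re by linarith)]
  exact summable_norm_add_rpow Λ (by linarith) u

lemma summable_conjSqTerm {s : ℂ} (hs : 1 < s.re) :
    Summable fun z : Λ ↦ conjSqTerm s z := by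
  refine .of_norm ?_
  simp_rw [norm_conjSqTerm (show 1 / 2 < s.re by linarith)]
  exact summable_norm_rpow_lattice Λ (by linarith)

lemma tsum_conjTerm_add (hq : ∀ s : ℂ, ∑' z : Λ, conjSqTerm s z = 0) (u : ℂ) {s : ℂ}
    (hs : 3 / 2 < s.re) :
    ∑' z : Λ, conjTerm s (u + z) = ∑' z : Λ, conjRemainder u s z +
      (1 - s) * (starRingEnd ℂ) u * ∑' z : Λ, (normSq (z : ℂ) : ℂ) ^ (-s) := by
  have h1 := summable_conjTerm_add Λ u hs
  have h2 : Summable fun z : Λ ↦ conjTerm s z := by simpa using summable_conjTerm_add Λ 0 hs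
  have h3 := summable_conjSqTerm Λ (s := s) (by linarith)
  have h4 := summable_normSq_cpow Λ (s := s) (by linarith)
  unfold conjRemainder
  rw [((h1.sub h2).add (h3.mul_left _)).tsum_sub (h4.mul_left _),
    (h1.sub h2).tsum_add (h3.mul_left _), h1.tsum_sub h2, tsum_mul_left, tsum_mul_left, hq,
    tsum_conjTerm]
  ring

end Lattice

section Eisenstein

lemma rho3_re : ρ3.re = -1 / 2 := by
  have h : (2 * Real.pi * I / 3 : ℂ) = ((2 * Real.pi / 3 : ℝ) : ℂ) * I := by push_cast; ring
  rw [ρ3, h, exp_ofReal_mul_I_re, show 2 * Real.pi / 3 = Real.pi - Real.pi / 3 by ring,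
    Real.cos_pi_sub, Real.cos_pi_div_three]
  norm_num

lemma rho3_im : ρ3.im = √3 / 2 := by
  have h : (2 * Real.pi * I / 3 : ℂ) = ((2 * Real.pi / 3 : ℝ) : ℂ) * I := by push_cast; ring
  rw [ρ3, h, exp_ofReal_mul_I_im, show 2 * Real.pi / 3 = Real.pi - Real.pi / 3 by ring,
    Real.sin_pi_sub, Real.sin_pi_div_three]

lemma rho3_sq : ρ3 ^ 2 = -1 - ρ3 := by
  have h3 : √3 * √3 = 3 := Real.mul_self_sqrt (by norm_num)
  apply Complex.ext
  · simp only [sq, mul_re, sub_re, neg_re, one_re, rho3_re, rho3_im]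
    linarith
  · simp only [sq, mul_im, sub_im, neg_im, one_im, rho3_re, rho3_im]
    ring

lemma rho3_cube : ρ3 ^ 3 = 1 := by
  linear_combination (ρ3 - 1) * rho3_sq

/-- The period pair `(1, ρ)`. -/
def eisensteinPair : PeriodPair where
  ω₁ := 1
  ω₂ := ρ3
  indep := by
    rw [LinearIndependent.pair_iff]
    intro s t h
    have h2 := congrArg im h
    have h1 := congrArg re h
    simp only [add_im, smul_im, one_im, rho3_im, add_re, smul_re, one_re, rho3_re, smul_eq_mul,
      zero_re, zero_im, mul_zero, mul_one, zero_add] at h1 h2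
    have ht : t = 0 := by
      have : √3 ≠ 0 := by positivity
      simpa [this] using h2
    subst ht
    exact ⟨by simpa using h1, rfl⟩

/-- The Eisenstein integers as a `ℤ`-lattice in `ℂ`. -/
abbrev eisensteinLattice : Submodule ℤ ℂ := eisensteinPair.lattice

lemma mem_eisensteinLattice {z : ℂ} : z ∈ eisensteinLattice ↔ ∃ m n : ℤ, m + n * ρ3 = z := by
  rw [PeriodPair.mem_lattice]
  simp [eisensteinPair]

lemma rho3_mem_O3 : ρ3 ∈ O3 := Subring.subset_closure rfl

lemma mem_O3_iff {z : ℂ} : z ∈ O3 ↔ z ∈ eisensteinLattice := by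
  rw [mem_eisensteinLattice]
  constructor
  · intro hz
    induction hz using Subring.closure_induction with
    | mem x hx => exact ⟨0, 1, by simpa using hx.symm⟩
    | zero => exact ⟨0, 0, by simp⟩
    | one => exact ⟨1, 0, by simp⟩
    | add x y _ _ hx hy =>
      obtain ⟨a, b, rfl⟩ := hx
      obtain ⟨c, d, rfl⟩ := hy
      exact ⟨a + c, b + d, by push_cast; ring⟩
    | neg x _ hx =>
      obtain ⟨a, b, rfl⟩ := hx
      exact ⟨-a, -b, by push_cast; ring⟩
    | mul x y _ _ hx hy =>
      obtain ⟨a, b, rfl⟩ := hx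
      obtain ⟨c, d, rfl⟩ := hy
      exact ⟨a * c - b * d, a * d + b * c - b * d, by
        push_cast; linear_combination -(b * d : ℂ) * rho3_sq⟩
  · rintro ⟨m, n, rfl⟩
    exact add_mem (intCast_mem _ _) (mul_mem (intCast_mem _ _) rho3_mem_O3)

/-- The identification of `ℤ[ρ]` with the lattice it spans. -/
def equivO3 : O3 ≃ eisensteinLattice := Equiv.subtypeEquivRight fun _ ↦ mem_O3_iff

lemma rho3_mul_mem {z : ℂ} (hz : z ∈ eisensteinLattice) : ρ3 * z ∈ eisensteinLattice :=
  mem_O3_iff.1 (mul_mem rho3_mem_O3 (mem_O3_iff.2 hz))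

/-- Multiplication by `ρ` on the Eisenstein lattice. -/
def rho3Equiv : eisensteinLattice ≃ eisensteinLattice where
  toFun z := ⟨ρ3 * z, rho3_mul_mem z.2⟩
  invFun z := ⟨ρ3 * (ρ3 * z), rho3_mul_mem (rho3_mul_mem z.2)⟩
  left_inv z := Subtype.ext (by
    show ρ3 * (ρ3 * (ρ3 * (z : ℂ))) = z
    linear_combination (z : ℂ) * rho3_cube)
  right_inv z := Subtype.ext (by
    show ρ3 * (ρ3 * (ρ3 * (z : ℂ))) = z
    linear_combination (z : ℂ) * rho3_cube)

lemma normSq_rho3 : normSq ρ3 = 1 := by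
  have h3 : √3 * √3 = 3 := Real.mul_self_sqrt (by norm_num)
  rw [normSq_apply, rho3_re, rho3_im]; linarith

lemma tsum_conjSqTerm (s : ℂ) : ∑' z : eisensteinLattice, conjSqTerm s z = 0 := by
  have h := rho3Equiv.tsum_eq fun z ↦ conjSqTerm s z
  have h1 (z : eisensteinLattice) : conjSqTerm s (rho3Equiv z) =
      conjSqTerm s ρ3 * conjSqTerm s z := conjSqTerm_mul s ρ3 z
  simp_rw [h1, tsum_mul_left] at h
  have h2 : conjSqTerm s ρ3 ≠ 1 := by
    rw [conjSqTerm, normSq_rho3, ofReal_one, one_cpow, mul_one, ← map_pow, rho3_sq]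
    intro h
    have := congrArg re h
    simp [rho3_re] at this
    norm_num at this
  by_contra h0
  exact h2 ((mul_eq_right₀ h0).1 h)

lemma covolume_eisensteinLattice : ZLattice.covolume eisensteinLattice = √3 / 2 := by
  have hvol : MeasureTheory.volume.real (ZSpan.fundamentalDomain basisOneI) = 1 := by
    rw [MeasureTheory.measureReal_congr (ZSpan.fundamentalDomain_ae_parallelepiped _ _),
      ← toBasis_orthonormalBasisOneI, OrthonormalBasis.coe_toBasis, MeasureTheory.measureReal_def,
      OrthonormalBasis.volume_parallelepiped, ENNReal.toReal_one]
  rw [ZLattice.covolume_eq_det_mul_measureReal eisensteinLattice (μ := MeasureTheory.volume)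
      (b := eisensteinPair.latticeBasis) (b₀ := basisOneI), hvol,
    mul_one, Module.Basis.det_apply, Matrix.det_fin_two]
  have h0 : (eisensteinPair.latticeBasis 0 : ℂ) = 1 := by
    rw [PeriodPair.latticeBasis_zero]; rfl
  have h1 : (eisensteinPair.latticeBasis 1 : ℂ) = ρ3 := by
    rw [PeriodPair.latticeBasis_one]; rfl
  simp [Module.Basis.toMatrix_apply, h0, h1, rho3_im]
  positivity

lemma exists_natCast_eq_normSq (z : eisensteinLattice) : ∃ n : ℕ, (n : ℝ) = normSq (z : ℂ) := by
  obtain ⟨a, b, h⟩ := mem_eisensteinLattice.1 z.2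
  have h3 : √3 * √3 = 3 := Real.mul_self_sqrt (by norm_num)
  have h1 : normSq (z : ℂ) = ((a ^ 2 - a * b + b ^ 2 : ℤ) : ℝ) := by
    rw [← h, normSq_apply]
    simp only [add_re, mul_re, add_im, mul_im, intCast_re, intCast_im, rho3_re, rho3_im]
    push_cast
    linear_combination (b ^ 2 / 4 : ℝ) * h3
  have h2 : 0 ≤ a ^ 2 - a * b + b ^ 2 := by nlinarith [sq_nonneg (a - b), sq_nonneg (a + b)]
  refine ⟨(a ^ 2 - a * b + b ^ 2).toNat, ?_⟩
  rw [h1]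
  exact_mod_cast Int.toNat_of_nonneg h2

/-- The norm `|z|²` of an Eisenstein integer, as a natural number. -/
def eisensteinNorm (z : eisensteinLattice) : ℕ := (exists_natCast_eq_normSq z).choose

lemma eisensteinNorm_spec (z : eisensteinLattice) : (eisensteinNorm z : ℝ) = normSq (z : ℂ) :=
  (exists_natCast_eq_normSq z).choose_spec

lemma finite_eisensteinNorm_le (n : ℕ) : {z | eisensteinNorm z ≤ n}.Finite := by
  refine (eventually_cofinite_lt_norm eisensteinLattice √n).subset fun z hz ↦ ?_
  have h : (eisensteinNorm z : ℝ) ≤ n := by exact_mod_cast hz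
  rw [eisensteinNorm_spec, normSq_eq_norm_sq] at h
  simpa using Real.le_sqrt_of_sq_le h

/-- The number of Eisenstein integers of norm `n`. -/
def eisensteinCount (n : ℕ) : ℕ := (eisensteinNorm ⁻¹' {n}).ncard

lemma sum_eisensteinCount (n : ℕ) :
    ∑ k ∈ Finset.range (n + 1), eisensteinCount k = {z | eisensteinNorm z ≤ n}.ncard := by
  have hfin := finite_eisensteinNorm_le n
  rw [Set.ncard_eq_toFinset_card _ hfin, Finset.card_eq_sum_card_fiberwise (f := eisensteinNorm)
    (t := Finset.range (n + 1)) fun z hz ↦ by simpa [Nat.lt_succ_iff] using hz]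
  refine Finset.sum_congr rfl fun k hk ↦ ?_
  rw [eisensteinCount, ← Set.ncard_coe_finset]
  congr 1
  ext z
  simp only [Finset.mem_range] at hk
  simp
  omega

lemma tendsto_ncard_eisensteinNorm_le :
    Tendsto (fun n : ℕ ↦ ({z | eisensteinNorm z ≤ n}.ncard : ℝ) / n) atTop
      (𝓝 (2 * Real.pi / √3)) := by
  have hball : {x : ℂ | x ∈ Set.univ ∧ normSq x ≤ 1} = Metric.closedBall 0 1 := by
    ext x
    simp [normSq_eq_norm_sq]
  have h := ZLattice.covolume.tendsto_card_le_div' eisensteinLattice (X := Set.univ)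
    (F := fun x ↦ normSq x) (by simp) (fun x r _ ↦ by
      rw [finrank_real_complex, real_smul, map_mul, normSq_ofReal]; ring)
    (by rw [hball]; exact Metric.isBounded_closedBall)
    (by rw [hball]; exact measurableSet_closedBall)
    (by rw [hball]; exact (convex_closedBall _ _).addHaar_frontier _)
  rw [hball, covolume_eisensteinLattice, MeasureTheory.measureReal_def, volume_closedBall] at h
  have h2 : Real.pi / (√3 / 2) = 2 * Real.pi / √3 := by field_simp
  simp only [ENNReal.ofReal_one, one_pow, one_mul, ENNReal.coe_toReal, NNReal.coe_real_pi, h2] at h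
  refine (h.comp tendsto_natCast_atTop_atTop).congr fun n ↦ ?_
  simp only [Function.comp_apply]
  congr 2
  rw [Nat.card_coe_set_eq, ← Set.ncard_image_of_injective _ Subtype.val_injective]
  congr 1
  ext x
  simp only [Set.mem_inter_iff, Set.mem_image, Subtype.exists, SetLike.mem_coe, Set.mem_ofPred_eq]
  constructor
  · rintro ⟨⟨-, h⟩, hx⟩
    refine ⟨x, hx, ?_, rfl⟩
    rw [← eisensteinNorm_spec ⟨x, hx⟩] at h
    exact_mod_cast h
  · rintro ⟨y, hy, h, rfl⟩
    refine ⟨⟨trivial, ?_⟩, hy⟩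
    rw [← eisensteinNorm_spec ⟨y, hy⟩]
    exact_mod_cast h

lemma tendsto_sum_eisensteinCount :
    Tendsto (fun n : ℕ ↦ (∑ k ∈ Finset.Icc 1 n, (eisensteinCount k : ℝ)) / n) atTop
      (𝓝 (2 * Real.pi / √3)) := by
  have h0 : Tendsto (fun n : ℕ ↦ (eisensteinCount 0 : ℝ) / n) atTop (𝓝 0) :=
    tendsto_const_div_atTop_nhds_zero_nat _
  have h := tendsto_ncard_eisensteinNorm_le.sub h0
  rw [sub_zero] at h
  refine h.congr fun n ↦ ?_
  rw [← sum_eisensteinCount, Finset.range_eq_Ico, Finset.sum_eq_sum_Ico_succ_bot (by omega),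
    Nat.cast_add, Nat.cast_sum]
  have : Finset.Ico (0 + 1) (n + 1) = Finset.Icc 1 n := by ext; simp
  rw [this]
  ring

lemma tsum_normSq_cpow_eq_LSeries {s : ℂ} (hs : 1 < s.re) :
    ∑' z : eisensteinLattice, (normSq (z : ℂ) : ℂ) ^ (-s) =
      LSeries (fun n ↦ ((eisensteinCount n : ℝ) : ℂ)) s := by
  have h := (summable_normSq_cpow eisensteinLattice hs).hasSum.tsum_fiberwise eisensteinNorm
  rw [← h.tsum_eq, LSeries]
  have hs0 : s ≠ 0 := by
    rintro rfl
    simp only [zero_re] at hs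
    linarith
  refine tsum_congr fun n ↦ ?_
  have h1 (z : eisensteinNorm ⁻¹' {n}) : (normSq (z.1 : ℂ) : ℂ) ^ (-s) = (n : ℂ) ^ (-s) := by
    rw [← eisensteinNorm_spec, show eisensteinNorm z.1 = n from z.2, ofReal_natCast]
  simp_rw [h1]
  rw [tsum_const, Nat.card_coe_set_eq, nsmul_eq_mul]
  rcases eq_or_ne n 0 with rfl | hn
  · simp [hs0]
  · rw [LSeries.term_of_ne_zero hn, cpow_neg, eisensteinCount, ofReal_natCast, div_eq_mul_inv]

lemma tendsto_sub_one_mul_tsum_normSq_cpow :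
    Tendsto (fun s : ℝ ↦ ((s : ℂ) - 1) *
      ∑' z : eisensteinLattice, (normSq (z : ℂ) : ℂ) ^ (-(s : ℂ))) (𝓝[>] 1)
      (𝓝 ((2 * Real.pi / √3 : ℝ) : ℂ)) := by
  refine (LSeries_tendsto_sub_mul_nhds_one_of_tendsto_sum_div_and_nonneg _
    tendsto_sum_eisensteinCount fun n ↦ Nat.cast_nonneg _).congr' ?_
  filter_upwards [self_mem_nhdsWithin] with s hs
  rw [tsum_normSq_cpow_eq_LSeries (by simpa using hs)]

end Eisenstein

section Weierstrass

lemma conjTerm_one (z : ℂ) : conjTerm 1 z = z⁻¹ := by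
  rw [conjTerm, cpow_neg_one, inv_def z, ofReal_inv]

lemma conjSqTerm_one (z : ℂ) : conjSqTerm 1 z = (z ^ 2)⁻¹ := by
  rw [conjSqTerm, show (-(1 + 1) : ℂ) = ((-2 : ℤ) : ℂ) by norm_num, cpow_intCast, zpow_neg,
    show (2 : ℤ) = ((2 : ℕ) : ℤ) from rfl, zpow_natCast, ← inv_pow, ← inv_pow, ← mul_pow,
    inv_def z, ofReal_inv]

lemma conjRemainder_one (u z : ℂ) :
    conjRemainder u 1 z = (u + z)⁻¹ - z⁻¹ + u * (z ^ 2)⁻¹ := by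
  rw [conjRemainder, conjTerm_one, conjTerm_one, conjSqTerm_one]; ring

lemma coe_latticeEquivProd_symm (m : ℤ × ℤ) :
    ((eisensteinPair.latticeEquivProd.symm m : eisensteinLattice) : ℂ) = m.1 + m.2 * ρ3 := by
  rw [PeriodPair.latticeEquiv_symm_apply]
  simp [eisensteinPair]

lemma wzeta3_eq_tsum (u : ℂ) :
    wzeta3 (varpi1 * u) = (varpi1 : ℂ)⁻¹ * ∑' z : eisensteinLattice, conjRemainder u 1 z := by
  have hs := summable_conjRemainder eisensteinLattice u (s := 1) (by norm_num)
  rw [hs.tsum_eq_add_tsum_ite 0, mul_add, wzeta3, conjRemainder_one, ← tsum_mul_left]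
  congr 1
  · simp [mul_comm]
  · rw [← (eisensteinPair.latticeEquivProd.toEquiv.symm.trans (Equiv.neg _)).tsum_eq]
    refine tsum_congr fun m ↦ ?_
    by_cases hm : m = 0
    · simp [hm]
    · have h0 : eisensteinPair.latticeEquivProd.symm m ≠ 0 := by simpa using hm
      simp only [hm, if_false, Equiv.trans_apply, Equiv.neg_apply, neg_eq_zero,
        LinearEquiv.coe_toEquiv_symm, EquivLike.coe_coe, h0,
        conjRemainder_one, Submodule.coe_neg, coe_latticeEquivProd_symm, ω3]
      generalize (m.1 + m.2 * ρ3 : ℂ) = v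
      generalize (varpi1 : ℂ) = w
      rcases eq_or_ne w 0 with rfl | hw
      · simp
      · rw [← mul_sub, mul_inv, mul_inv, mul_pow, mul_inv, neg_sq, inv_neg, ← sub_eq_add_neg]
        field_simp
        ring

lemma Z3_eq_tsum (u : ℂ) :
    Z3 u = (varpi1 : ℂ)⁻¹ * (∑' z : eisensteinLattice, conjRemainder u 1 z
      - ((2 * Real.pi / √3 : ℝ) : ℂ) * (starRingEnd ℂ) u) := by
  rw [Z3, wzeta3_eq_tsum, ← div_div, ofReal_div _ varpi1]
  ring

end Weierstrass

section HeckeSeries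

variable {β : ℂ} {T : Finset ℂ}

lemma bijective_residue_add_mul (hβ : β ∈ O3) (hβ0 : β ≠ 0) (hT : IsCRS3 β T) :
    Function.Bijective fun p : T × O3 ↦
      (⟨p.1 + β * p.2, add_mem (hT.1 _ p.1.2) (mul_mem hβ p.2.2)⟩ : O3) := by
  constructor
  · rintro ⟨⟨a, ha⟩, x⟩ ⟨⟨b, hb⟩, y⟩ h
    have h' : a + β * (x : ℂ) = b + β * (y : ℂ) := congrArg Subtype.val h
    obtain rfl : a = b := hT.2.1 a ha b hb
      ⟨y - x, sub_mem y.2 x.2, by linear_combination h'⟩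
    have : (x : ℂ) = y := mul_left_cancel₀ hβ0 (add_left_cancel h')
    rw [Subtype.ext this]
  · rintro ⟨z, hz⟩
    obtain ⟨a, ha, d, hd, h⟩ := hT.2.2 z hz
    exact ⟨⟨⟨a, ha⟩, ⟨d, hd⟩⟩, Subtype.ext (by linear_combination -h)⟩

lemma tsum_residue_eq {χ : ℂ → ℂ} (hχ : IsResChar3 β χ) (hβ : β ∈ O3) (hβ0 : β ≠ 0)
    (hT : IsCRS3 β T) {s : ℂ} (hs : 3 / 2 < s.re) :
    ∑' ν : O3, χ ν * (starRingEnd ℂ) (ν : ℂ) * (normSq (ν : ℂ) : ℂ) ^ (-s) =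
      ∑ l ∈ T, χ l * (conjTerm s β * ∑' z : eisensteinLattice, conjTerm s (l / β + z)) := by
  have hterm (l : T) (z : O3) :
      χ (l + β * z) * (starRingEnd ℂ) (l + β * z : ℂ) * (normSq (l + β * z : ℂ) : ℂ) ^ (-s) =
        χ l * (conjTerm s β * conjTerm s (l / β + z)) := by
    have h1 : χ (l + β * z) = χ l := hχ.periodic _ (add_mem (hT.1 _ l.2) (mul_mem hβ z.2)) _
      (hT.1 _ l.2) ⟨z, z.2, by ring⟩
    rw [h1, mul_assoc, ← conjTerm_mul, mul_add, mul_div_cancel₀ _ hβ0]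
    rfl
  have hsum (l : ℂ) : Summable fun z : O3 ↦ χ l * (conjTerm s β * conjTerm s (l / β + z)) :=
    ((equivO3.summable_iff.2 (summable_conjTerm_add eisensteinLattice (l / β) hs)).mul_left
      _).mul_left _
  have hprod : Summable fun p : T × O3 ↦
      χ p.1 * (conjTerm s β * conjTerm s (p.1 / β + p.2)) := by
    refine .of_norm ((summable_prod_of_nonneg fun _ ↦ norm_nonneg _).2
      ⟨fun l ↦ (hsum l).norm, (hasSum_fintype _).summable⟩)
  rw [← (Equiv.ofBijective _ (bijective_residue_add_mul hβ hβ0 hT)).tsum_eq]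
  simp only [Equiv.ofBijective_apply, hterm]
  rw [hprod.tsum_prod' fun l ↦ hsum l, tsum_fintype, ← Finset.sum_coe_sort T]
  refine Finset.sum_congr rfl fun l _ ↦ ?_
  simp only [tsum_mul_left]
  rw [← equivO3.tsum_eq]
  rfl

end HeckeSeries

/-- **Lemma I.3.** Let `χ̃` be a Hecke character of weight one of `ℚ(ρ)` with conductor
`(β)`. Then `ϖ₁⁻¹·L(1, χ̃) = (1/(6β))·Σ_{λ mod β} χ₁(λ)·Z(λ/β)`. -/
theorem stmt_7
    (β : ℂ) (χ₁ : ℂ → ℂ) (hχ₁ : IsHeckeCond3 β χ₁)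
    (T : Finset ℂ) (hT : IsCRS3 β T)
    (L : ℂ) (hL : IsLValue3 χ₁ L) :
    ((varpi1 : ℂ))⁻¹ * L = (1 / (6 * β)) * ∑ l ∈ T, χ₁ l * Z3 (l / β) := by
  obtain ⟨hβ, hβ0, hχ, -, -⟩ := hχ₁
  obtain ⟨F, hF, hFs, rfl⟩ := hL
  let G : ℂ → ℂ → ℂ := fun u s ↦ ∑' z : eisensteinLattice, conjRemainder u s z
  let E : ℂ → ℂ := fun s ↦ ∑' z : eisensteinLattice, (normSq (z : ℂ) : ℂ) ^ (-s)
  let H : ℂ → ℂ := fun s ↦ (1 / 6 : ℂ) * ∑ l ∈ T, χ₁ l * (conjTerm s β *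
    (G (l / β) s + (1 - s) * (starRingEnd ℂ) (l / β) * E s))
  have hopen : IsOpen {s : ℂ | 1 < s.re} := isOpen_lt continuous_const continuous_re
  have hβd (s : ℂ) : DifferentiableAt ℂ (fun s ↦ conjTerm s β) s :=
    (differentiableAt_id.neg.const_cpow (.inl (by simpa using hβ0))).const_mul _
  have hH : DifferentiableOn ℂ H {s | 1 < s.re} := by
    intro s hs
    have hE : DifferentiableAt ℂ E s :=
      (differentiableOn_tsum_normSq_cpow eisensteinLattice).differentiableAt (hopen.mem_nhds hs)
    have hG (u : ℂ) : DifferentiableAt ℂ (G u) s :=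
      (differentiableOn_tsum_conjRemainder eisensteinLattice u).differentiableAt
        ((isOpen_lt continuous_const continuous_re).mem_nhds
          (lt_trans (by norm_num) (show 1 < s.re from hs)))
    refine DifferentiableAt.differentiableWithinAt ?_
    refine (DifferentiableAt.fun_sum fun l _ ↦ ?_).const_mul _
    exact ((hβd s).mul ((hG _).add (((differentiableAt_const _).sub
      differentiableAt_id).mul_const _ |>.mul hE))).const_mul _
  have hEq : Set.EqOn F H {s | 1 < s.re} := by
    have hFd : DifferentiableOn ℂ F {s | 1 < s.re} :=
      hF.mono fun s hs ↦ lt_trans one_pos (show 1 < s.re from hs)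
    refine (hFd.analyticOnNhd hopen).eqOn_of_preconnected_of_eventuallyEq
      (hH.analyticOnNhd hopen) (convex_halfSpace_re_gt 1).isPreconnected (z₀ := 2) (by simp) ?_
    filter_upwards [(isOpen_lt continuous_const continuous_re).mem_nhds
      (show (3 / 2 : ℝ) < (2 : ℂ).re by norm_num)] with s hs
    rw [hFs s hs, tsum_residue_eq hχ hβ hβ0 hT hs]
    simp_rw [tsum_conjTerm_add eisensteinLattice tsum_conjSqTerm _ hs]
    rfl
  have hlim : Tendsto (fun s : ℝ ↦ (s : ℂ)) (𝓝[>] 1) (𝓝 1) := by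
    simpa using (continuous_ofReal.tendsto 1).mono_left nhdsWithin_le_nhds
  have hF1 : Tendsto (fun s : ℝ ↦ F s) (𝓝[>] 1) (𝓝 (F 1)) :=
    (hF.differentiableAt ((isOpen_lt continuous_const continuous_re).mem_nhds
      (by simp))).continuousAt.tendsto.comp hlim
  have hH1 : Tendsto (fun s : ℝ ↦ H s) (𝓝[>] 1) (𝓝 ((1 / 6 : ℂ) * ∑ l ∈ T, χ₁ l *
      (conjTerm 1 β * (G (l / β) 1 -
        ((2 * Real.pi / √3 : ℝ) : ℂ) * (starRingEnd ℂ) (l / β))))) := by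
    refine (tendsto_finsetSum _ fun l _ ↦ ?_).const_mul _
    rw [sub_eq_add_neg]
    refine (((hβd 1).continuousAt.tendsto.comp hlim).mul (Tendsto.add ?_ ?_)).const_mul _
    · exact ((differentiableOn_tsum_conjRemainder eisensteinLattice (l / β)).differentiableAt
        ((isOpen_lt continuous_const continuous_re).mem_nhds
          (by norm_num))).continuousAt.tendsto.comp hlim
    · have := tendsto_sub_one_mul_tsum_normSq_cpow.neg.mul_const ((starRingEnd ℂ) (l / β))
      rw [neg_mul] at this
      refine this.congr fun s ↦ ?_
      simp only [E]
      ring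
  have hval := tendsto_nhds_unique (hF1.congr' (by
    filter_upwards [self_mem_nhdsWithin] with s hs
    exact hEq (by simpa using hs))) hH1
  simp only [hval, Z3_eq_tsum, conjTerm_one, Finset.mul_sum]
  refine Finset.sum_congr rfl fun l _ ↦ ?_
  simp only [G]
  field_simp

end
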